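/- arXiv:1502.00126 — 11 statements merged into one kernel-verified Lean document; each statement's English description precedes it below -/
import Mathlib

section
/- A metric space X is injective if and only if it is hyperconvex, i.e., every collection of closed balls {B(p_i, r_i)}_{i ∈ I} in X whose centers and radii satisfy r_i + r_j ≥ d(p_i, p_j) for all i, j ∈ I has a common point. -/
/-- A metric space `X` is *injective* if for every pair of metric spaces `A`, `B`,
every isometric embedding `i : A → B` and every 1-Lipschitz (non-expansive) map
`f : A → X`, there is a 1-Lipschitz map `F : B → X` with `F ∘ i = f`. -/
def IsInjectiveMetricSpace (X : Type) [MetricSpace X] : Prop :=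
  ∀ (A B : Type) [MetricSpace A] [MetricSpace B] (i : A → B) (f : A → X),
    Isometry i → LipschitzWith 1 f →
      ∃ F : B → X, LipschitzWith 1 F ∧ F ∘ i = f

open scoped BoundedContinuousFunction

/-- An injective metric space is nonempty. -/
theorem IsInjectiveMetricSpace.nonempty {X : Type} [MetricSpace X]
    (hX : IsInjectiveMetricSpace X) : Nonempty X := by
  obtain ⟨F, -, -⟩ := hX Empty Unit Empty.elim Empty.elim (fun a => a.elim) (fun a => a.elim)
  exact ⟨F ()⟩

/-- A function `g` on an injective metric space with `g x ≤ g y + dist x y` and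
`dist x y ≤ g x + g y` is bounded below by the distance to some point. -/
theorem IsInjectiveMetricSpace.exists_dist_le {X : Type} [MetricSpace X]
    (hX : IsInjectiveMetricSpace X) {g : X → ℝ} (hg : ∀ x y, g x ≤ g y + dist x y)
    (hdist : ∀ x y, dist x y ≤ g x + g y) : ∃ z : X, ∀ x, dist z x ≤ g x := by
  obtain ⟨x₀⟩ := hX.nonempty
  have hcont : Continuous g := (LipschitzWith.of_le_add hg).continuous
  let e : X → X →ᵇ ℝ := fun x =>
    .ofNormedAddCommGroup (fun y => dist x y - dist x₀ y) (by fun_prop) (dist x x₀) fun y => by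
      simpa [Real.dist_eq] using dist_dist_dist_le_left x x₀ y
  let γ : X →ᵇ ℝ :=
    .ofNormedAddCommGroup (fun y => g y - dist x₀ y) (by fun_prop) (g x₀) fun y => by
      rw [Real.norm_eq_abs, abs_le]
      constructor <;> linarith [hg y x₀, hdist x₀ y, dist_comm x₀ y]
  have he : Isometry e := by
    refine Isometry.of_dist_eq fun x y => le_antisymm ?_ ?_
    · refine (BoundedContinuousFunction.dist_le dist_nonneg).2 fun z => ?_
      simpa [e, Real.dist_eq] using dist_dist_dist_le_left x y z
    · simpa [e, Real.dist_eq] using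
        BoundedContinuousFunction.dist_coe_le_dist (f := e x) (g := e y) y
  obtain ⟨F, hF, hFe⟩ := hX X (X →ᵇ ℝ) e id he LipschitzWith.id
  refine ⟨F γ, fun x => ?_⟩
  calc dist (F γ) x = dist (F γ) (F (e x)) := by rw [show F (e x) = x from congrFun hFe x]
    _ ≤ dist γ (e x) := by simpa using hF.dist_le_mul γ (e x)
    _ ≤ g x := by
      refine (BoundedContinuousFunction.dist_le (by linarith [hdist x x, dist_self x])).2
        fun y => ?_
      have : dist (γ y) (e x y) = |g y - dist x y| := by simp [γ, e, Real.dist_eq]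
      rw [this, abs_le]
      constructor <;> linarith [hg y x, hdist x y, dist_comm x y]

/-- In an injective metric space, a family of closed balls that satisfies the obvious
necessary condition on centers and radii has a common point. -/
theorem IsInjectiveMetricSpace.exists_forall_dist_le {X : Type} [MetricSpace X]
    (hX : IsInjectiveMetricSpace X) {I : Type} {p : I → X} {r : I → ℝ}
    (h : ∀ i j, dist (p i) (p j) ≤ r i + r j) : ∃ x : X, ∀ i, dist x (p i) ≤ r i := by
  cases isEmpty_or_nonempty I with
  | inl hI => exact hX.nonempty.elim fun x => ⟨x, fun i => hI.elim i⟩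
  | inr hI =>
    have hr (i : I) : 0 ≤ r i := by linarith [h i i, dist_self (p i)]
    let g : X → ℝ := fun x => ⨅ i, (r i + dist x (p i))
    have hle (x : X) (i : I) : g x ≤ r i + dist x (p i) :=
      ciInf_le ⟨0, by rintro _ ⟨j, rfl⟩; exact add_nonneg (hr j) dist_nonneg⟩ i
    obtain ⟨z, hz⟩ := hX.exists_dist_le (g := g)
      (fun x y => by
        rw [← sub_le_iff_le_add]
        refine le_ciInf fun i => ?_
        linarith [hle x i, dist_triangle x y (p i)])
      (fun x y => by
        rw [← sub_le_iff_le_add]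
        refine le_ciInf fun i => ?_
        rw [sub_le_comm]
        refine le_ciInf fun j => ?_
        linarith [h i j, dist_triangle4 x (p i) (p j) y, dist_comm y (p j)])
    exact ⟨z, fun i => (hz (p i)).trans (by simpa using hle (p i) i)⟩

/-- The extension property of a hyperconvex metric space, by Zorn's lemma applied to the graphs
of partial 1-Lipschitz maps. -/
theorem IsInjectiveMetricSpace.of_hyperconvex {X : Type} [MetricSpace X]
    (hX : ∀ (I : Type) (p : I → X) (r : I → ℝ),
      (∀ i j : I, dist (p i) (p j) ≤ r i + r j) → ∃ x : X, ∀ i : I, dist x (p i) ≤ r i) :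
    IsInjectiveMetricSpace X := by
  intro A B _ _ i f hi hf
  let S : Set (Set (B × X)) := {G | ∀ u ∈ G, ∀ v ∈ G, dist u.2 v.2 ≤ dist u.1 v.1}
  have hgraph : Set.range (fun a => (i a, f a)) ∈ S := by
    rintro _ ⟨a, rfl⟩ _ ⟨b, rfl⟩
    simpa [hi.dist_eq] using hf.dist_le_mul a b
  obtain ⟨G, hsub, hG⟩ := zorn_subset_nonempty S
    (fun c hc hchain _ => ⟨⋃₀ c, by
      rintro u ⟨s, hs, hu⟩ v ⟨t, ht, hv⟩
      rcases hchain.total hs ht with hst | hts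
      · exact hc ht u (hst hu) v hv
      · exact hc hs u hu v (hts hv), fun _ => Set.subset_sUnion_of_mem⟩) _ hgraph
  have htotal (b : B) : ∃ x, (b, x) ∈ G := by
    obtain ⟨x, hx⟩ := hX G (fun u => u.1.2) (fun u => dist b u.1.1) fun u v =>
      (hG.prop u u.2 v v.2).trans (dist_triangle_left _ _ _)
    refine ⟨x, hG.le_of_ge (y := insert (b, x) G) ?_ (Set.subset_insert _ _)
      (Set.mem_insert _ _)⟩
    rintro u (rfl | hu) v (rfl | hv)
    · simp
    · exact hx ⟨v, hv⟩
    · rw [dist_comm u.2, dist_comm u.1]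
      exact hx ⟨u, hu⟩
    · exact hG.prop u hu v hv
  choose F hF using htotal
  refine ⟨F, LipschitzWith.of_dist_le_mul fun b c => ?_, funext fun a => ?_⟩
  · simpa using hG.prop _ (hF b) _ (hF c)
  · simpa using hG.prop _ (hF (i a)) _ (hsub ⟨a, rfl⟩)

/-- A metric space is injective iff it is hyperconvex: every collection of closed
balls `B(p i, r i)` with `r i + r j ≥ dist (p i) (p j)` for all `i, j` has a
common point. -/
theorem injective_iff_hyperconvex (X : Type) [MetricSpace X] :
    IsInjectiveMetricSpace X ↔
      ∀ (I : Type) (p : I → X) (r : I → ℝ),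
        (∀ i j : I, dist (p i) (p j) ≤ r i + r j) →
          ∃ x : X, ∀ i : I, dist x (p i) ≤ r i := by
  exact ⟨fun hX _ _ _ h => hX.exists_forall_dist_le h, .of_hyperconvex⟩
end

section
/- In an injective metric space X, every triple of points has a median: for all x, y, z ∈ X the set I(x,y) ∩ I(x,z) ∩ I(y,z) is nonempty. -/
/-- The metric interval `I(x,y) = {z | d(x,z) + d(z,y) = d(x,y)}`. -/
def MetricInterval {X : Type} [PseudoMetricSpace X] (x y : X) : Set X :=
  {z | dist x z + dist z y = dist x y}

/-- The map recording the distances to `x`, `y`, `z` is isometric on `{x, y, z}`, for the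
sup metric on the product. -/
theorem isometry_dist_triple {X : Type} [PseudoMetricSpace X] (x y z : X) :
    Isometry fun p : ({x, y, z} : Set X) => (dist p.1 x, dist p.1 y, dist p.1 z) := by
  refine Isometry.of_dist_eq fun p q => le_antisymm ?_ ?_
  · simp only [Prod.dist_eq, Subtype.dist_eq, sup_le_iff]
    exact ⟨dist_dist_dist_le_left _ _ _, dist_dist_dist_le_left _ _ _,
      dist_dist_dist_le_left _ _ _⟩
  · obtain ⟨q, hq⟩ := q
    simp only [Prod.dist_eq, Subtype.dist_eq, le_sup_iff]
    rcases hq with rfl | rfl | rfl <;> simp [Real.dist_eq]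

/-- In an injective metric space every triple of points has a median:
`I(x,y) ∩ I(x,z) ∩ I(y,z)` is nonempty. -/
theorem medians_exist_of_injective {X : Type} [MetricSpace X]
    (hX : IsInjectiveMetricSpace X) (x y z : X) :
    (MetricInterval x y ∩ MetricInterval x z ∩ MetricInterval y z).Nonempty := by
  obtain ⟨F, hF, hFi⟩ := hX ({x, y, z} : Set X) (ℝ × ℝ × ℝ) _ Subtype.val
    (isometry_dist_triple x y z) (Isometry.lipschitz isometry_subtype_coe)
  let a := (dist x y + dist x z - dist y z) / 2
  let b := (dist x y + dist y z - dist x z) / 2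
  let c := (dist x z + dist y z - dist x y) / 2
  have ha : 0 ≤ a := by have := dist_triangle_left y z x; grind
  have hb : 0 ≤ b := by have := dist_triangle x y z; grind
  have hc : 0 ≤ c := by have := dist_triangle_right x y z; grind
  have key (p : X) (hp : p ∈ ({x, y, z} : Set X)) :
      dist (F (a, b, c)) p ≤ dist (a, b, c) (dist p x, dist p y, dist p z) := by
    have h := hF.dist_le_mul (a, b, c) (dist p x, dist p y, dist p z)
    have hp' : F (dist p x, dist p y, dist p z) = p := congrFun hFi ⟨p, hp⟩
    simpa [hp'] using h
  have hx : dist (F (a, b, c)) x ≤ a := by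
    refine (key x (by simp)).trans ?_
    simp only [Prod.dist_eq, Real.dist_eq, sup_le_iff, abs_le, dist_self]
    grind
  have hy : dist (F (a, b, c)) y ≤ b := by
    refine (key y (by simp)).trans ?_
    simp only [Prod.dist_eq, Real.dist_eq, sup_le_iff, abs_le, dist_self, dist_comm y x]
    grind
  have hz : dist (F (a, b, c)) z ≤ c := by
    refine (key z (by simp)).trans ?_
    simp only [Prod.dist_eq, Real.dist_eq, sup_le_iff, abs_le, dist_self, dist_comm z x,
      dist_comm z y]
    grind
  have hxy := dist_triangle_left x y (F (a, b, c))
  have hxz := dist_triangle_left x z (F (a, b, c))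
  have hyz := dist_triangle_left y z (F (a, b, c))
  refine ⟨F (a, b, c), ⟨?_, ?_⟩, ?_⟩ <;>
    simp only [MetricInterval, Set.mem_ofPred_eq, dist_comm x (F _), dist_comm y (F _)] <;>
    grind
end

section
/- Let (X_n, b_n), n ∈ ℕ, be pointed proper metric spaces, each of which is injective, and let (X, b) be a pointed proper metric space such that for every R > 0 the Gromov–Hausdorff distance between the closed ball B(b_n, R) in X_n and the closed ball B(b, R) in X (each equipped with the induced metric, and compact by properness) tends to 0 as n → ∞. Then X is injective. -/
/-- `GHApproxWithin A B ε` says that `A` and `B` admit isometric embeddings into a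
common metric space with Hausdorff distance of the images `< ε`.  The
Gromov–Hausdorff distance between `A` and `B` is the infimum of the Hausdorff
distances over all such embeddings, so it tends to `0` along a sequence iff
eventually `GHApproxWithin _ _ ε` holds for every `ε > 0`. -/
def GHApproxWithin (A B : Type) [MetricSpace A] [MetricSpace B] (ε : ℝ) : Prop :=
  ∃ (Z : Type) (iZ : MetricSpace Z),
    letI : MetricSpace Z := iZ
    ∃ (f : A → Z) (g : B → Z),
      Isometry f ∧ Isometry g ∧
        Metric.hausdorffDist (Set.range f) (Set.range g) < ε

/-- A metric space is *hyperconvex* if any family of closed balls `B(x i, r i)` satisfying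
`dist (x i) (x j) ≤ r i + r j` has a common point. -/
def IsHyperconvex (X : Type) [MetricSpace X] : Prop :=
  ∀ (ι : Type) (x : ι → X) (r : ι → ℝ), (∀ i j, dist (x i) (x j) ≤ r i + r j) →
    ∃ p, ∀ i, dist p (x i) ≤ r i

/-- A nonempty family of balls in `ℓ^∞` whose pairs satisfy the obvious necessary condition
has a common point. -/
theorem exists_common_point_lp {ι : Type} [Nonempty ι] (x : ι → lp (fun _ : ℕ => ℝ) ⊤)
    (r : ι → ℝ) (h : ∀ i j, dist (x i) (x j) ≤ r i + r j) : ∃ p, ∀ i, dist p (x i) ≤ r i := by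
  have hcoord (i j : ι) (k : ℕ) : x i k - r i ≤ x j k + r j := by
    have h1 : |x i k - x j k| ≤ dist (x i) (x j) := by
      rw [dist_eq_norm, ← Real.norm_eq_abs]
      exact lp.norm_apply_le_norm ENNReal.top_ne_zero (x i - x j) k
    linarith [le_abs_self (x i k - x j k), h i j]
  let p (k : ℕ) : ℝ := ⨆ i, (x i k - r i)
  have hp (j : ι) (k : ℕ) : |p k - x j k| ≤ r j := by
    have hle : p k ≤ x j k + r j := ciSup_le fun i => hcoord i j k
    have hge : x j k - r j ≤ p k :=
      le_ciSup (f := fun i => x i k - r i)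
        ⟨x j k + r j, by rintro _ ⟨i, rfl⟩; exact hcoord i j k⟩ j
    rw [abs_le]
    constructor <;> linarith
  obtain ⟨j₀⟩ := ‹Nonempty ι›
  have hmem : Memℓp (E := fun _ : ℕ => ℝ) p ⊤ := by
    refine memℓp_infty ⟨r j₀ + ‖x j₀‖, ?_⟩
    rintro _ ⟨k, rfl⟩
    have h1 := lp.norm_apply_le_norm ENNReal.top_ne_zero (x j₀) k
    rw [Real.norm_eq_abs] at h1
    have h2 := hp j₀ k
    change ‖p k‖ ≤ _
    rw [Real.norm_eq_abs]
    have h3 := abs_add_le (p k - x j₀ k) (x j₀ k)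
    rw [sub_add_cancel] at h3
    linarith
  refine ⟨⟨p, hmem⟩, fun i => ?_⟩
  have hr : 0 ≤ r i := (abs_nonneg _).trans (hp i 0)
  rw [dist_eq_norm]
  exact lp.norm_le_of_forall_le hr fun k => hp i k

theorem IsInjectiveMetricSpace.isHyperconvex {X : Type} [MetricSpace X]
    [TopologicalSpace.SeparableSpace X] [Nonempty X] (hX : IsInjectiveMetricSpace X) :
    IsHyperconvex X := by
  intro ι x r h
  obtain hι | hι := isEmpty_or_nonempty ι
  · exact ⟨Classical.arbitrary X, fun i => hι.elim i⟩
  have hiso := kuratowskiEmbedding.isometry X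
  obtain ⟨F, hF, hFi⟩ := hX X _ (kuratowskiEmbedding X) id hiso LipschitzWith.id
  obtain ⟨p, hp⟩ := exists_common_point_lp (fun i => kuratowskiEmbedding X (x i)) r
    fun i j => (hiso.dist_eq _ _).trans_le (h i j)
  refine ⟨F p, fun i => ?_⟩
  have hx : F (kuratowskiEmbedding X (x i)) = x i := congrFun hFi (x i)
  calc dist (F p) (x i) = dist (F p) (F (kuratowskiEmbedding X (x i))) := by rw [hx]
    _ ≤ dist p (kuratowskiEmbedding X (x i)) := by simpa using hF.dist_le_mul p _
    _ ≤ r i := hp i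

theorem IsHyperconvex.isInjectiveMetricSpace {X : Type} [MetricSpace X] (hX : IsHyperconvex X) :
    IsInjectiveMetricSpace X := by
  intro A B _ _ i f hi hf
  -- Graphs of partial 1-Lipschitz maps from `B` to `X`; a maximal one is total.
  let P : Set (Set (B × X)) := {G | ∀ p ∈ G, ∀ q ∈ G, dist p.2 q.2 ≤ dist p.1 q.1}
  have hstart : Set.range (fun a => (i a, f a)) ∈ P := by
    rintro _ ⟨a, rfl⟩ _ ⟨a', rfl⟩
    simpa [hi.dist_eq] using hf.dist_le_mul a a'
  obtain ⟨G, hG0, hG⟩ := zorn_subset_nonempty P (fun C hCP hC _ => by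
    refine ⟨⋃₀ C, ?_, fun s hs => Set.subset_sUnion_of_mem hs⟩
    rintro p ⟨s, hs, hps⟩ q ⟨t, ht, hqt⟩
    obtain hst | hts := hC.total hs ht
    · exact hCP ht p (hst hps) q hqt
    · exact hCP hs p hps q (hts hqt)) _ hstart
  have htotal (b : B) : ∃ y, (b, y) ∈ G := by
    obtain ⟨y, hy⟩ := hX G (fun p => p.1.2) (fun p => dist p.1.1 b) fun p q =>
      (hG.prop p.1 p.2 q.1 q.2).trans (dist_triangle_right _ _ _)
    refine ⟨y, hG.le_of_ge (y := insert (b, y) G) ?_ (Set.subset_insert _ _)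
      (Set.mem_insert _ _)⟩
    rintro p (rfl | hp) q (rfl | hq)
    · simp
    · simpa [dist_comm] using hy ⟨q, hq⟩
    · simpa [dist_comm] using hy ⟨p, hp⟩
    · exact hG.prop p hp q hq
  choose F hF using htotal
  refine ⟨F, LipschitzWith.of_dist_le_mul fun b b' => ?_, funext fun a => ?_⟩
  · simpa using hG.prop _ (hF b) _ (hF b')
  · have h := hG.prop _ (hF (i a)) _ (hG0 ⟨a, rfl⟩)
    simpa using h

/-- In a proper metric space it suffices to check hyperconvexity on finite families, up to an
arbitrarily small enlargement of the radii. -/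
theorem isHyperconvex_of_finite_approx {Y : Type} [MetricSpace Y] [ProperSpace Y] [Nonempty Y]
    (h : ∀ (ι : Type) [Finite ι] (y : ι → Y) (r : ι → ℝ),
      (∀ i j, dist (y i) (y j) ≤ r i + r j) → ∀ ε > 0, ∃ p, ∀ i, dist p (y i) ≤ r i + ε) :
    IsHyperconvex Y := by
  intro ι y r hr
  obtain hι | ⟨⟨i₀⟩⟩ := isEmpty_or_nonempty ι
  · exact ⟨Classical.arbitrary Y, fun i => hι.elim i⟩
  let S (t : ι × Set.Ioi (0 : ℝ)) : Set Y := Metric.closedBall (y t.1) (r t.1 + t.2)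
  obtain ⟨p, -, hp⟩ := (isCompact_closedBall (y i₀) (r i₀ + 1)).inter_iInter_nonempty S
    (fun t => Metric.isClosed_closedBall) (fun u => by
      classical
      let v : Finset (ι × Set.Ioi (0 : ℝ)) := insert (i₀, ⟨1, Set.mem_Ioi.2 one_pos⟩) u
      obtain ⟨t₀, -, ht₀⟩ :=
        v.exists_min_image (fun t => (t.2 : ℝ)) ⟨_, Finset.mem_insert_self _ _⟩
      obtain ⟨p, hp⟩ := h v (fun t => y t.1.1) (fun t => r t.1.1) (fun s t => hr _ _) t₀.2 t₀.2.2
      have hv (t) (ht : t ∈ v) : dist p (y t.1) ≤ r t.1 + t.2 :=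
        (hp ⟨t, ht⟩).trans (by gcongr; exact ht₀ t ht)
      exact ⟨p, hv _ (Finset.mem_insert_self _ _),
        Set.mem_iInter₂.2 fun t ht => hv t (Finset.mem_insert_of_mem ht)⟩)
  rw [Set.mem_iInter] at hp
  exact ⟨p, fun i => le_of_forall_pos_le_add fun ε hε => hp (i, ⟨ε, hε⟩)⟩

/-- A family of balls centred in `B(c, R)` has an approximate common point as soon as `B(c, R)` is
Gromov–Hausdorff close to a ball of the same radius in a hyperconvex space. -/
theorem IsHyperconvex.exists_approx_common_point {X Y : Type} [MetricSpace X] [MetricSpace Y]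
    (hX : IsHyperconvex X) {b : X} {c : Y} {R ε : ℝ} (hR : 0 ≤ R)
    (hGH : GHApproxWithin (Metric.closedBall b R) (Metric.closedBall c R) ε)
    {ι : Type} (y : ι → Y) (r : ι → ℝ) (hy : ∀ i, y i ∈ Metric.closedBall c R)
    (hr : ∀ i j, dist (y i) (y j) ≤ r i + r j) : ∃ q, ∀ i, dist q (y i) ≤ r i + 3 * ε := by
  obtain ⟨Z, _, f, g, hf, hg, hfg⟩ := hGH
  have : Nonempty (Metric.closedBall b R) := ⟨⟨b, Metric.mem_closedBall_self hR⟩⟩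
  have : Nonempty (Metric.closedBall c R) := ⟨⟨c, Metric.mem_closedBall_self hR⟩⟩
  have hbdd {W : Type} [MetricSpace W] (w : W) (φ : Metric.closedBall w R → Z)
      (hφ : Isometry φ) : Bornology.IsBounded (Set.range φ) := by
    have : BoundedSpace (Metric.closedBall w R) :=
      boundedSpace_val_set_iff.2 Metric.isBounded_closedBall
    exact Set.image_univ ▸ hφ.lipschitz.isBounded_image (Bornology.IsBounded.all _)
  have hfin := Metric.hausdorffEDist_ne_top_of_nonempty_of_bounded (Set.range_nonempty f)
    (Set.range_nonempty g) (hbdd b f hf) (hbdd c g hg)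
  have hnear (i : ι) : ∃ x, dist (f x) (g ⟨y i, hy i⟩) < ε := by
    obtain ⟨_, ⟨x, rfl⟩, hx⟩ :=
      Metric.exists_dist_lt_of_hausdorffDist_lt' (Set.mem_range_self ⟨y i, hy i⟩) hfg hfin
    exact ⟨x, hx⟩
  choose x hx using hnear
  have hε : 0 < ε := Metric.hausdorffDist_nonneg.trans_lt hfg
  have hxx (i j : ι) : dist (x i : X) (x j) ≤ r i + ε + (r j + ε) := by
    have h1 := dist_triangle4 (f (x i)) (g ⟨y i, hy i⟩) (g ⟨y j, hy j⟩) (f (x j))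
    rw [hf.dist_eq, hg.dist_eq, dist_comm _ (f (x j)), Subtype.dist_eq, Subtype.dist_eq] at h1
    linarith [hx i, hx j, hr i j]
  have hrad (i : ι) : 0 ≤ r i := by linarith [hr i i, dist_self (y i)]
  obtain ⟨p, hp⟩ := hX (Option ι) (fun o => o.elim b fun i => x i)
    (fun o => o.elim R fun i => r i + ε) (by
      rintro (_ | i) (_ | j)
      · simpa using hR
      · have := Metric.mem_closedBall'.1 (x j).2
        simp only [Option.elim]
        linarith [hrad j]
      · have := Metric.mem_closedBall.1 (x i).2
        simp only [Option.elim]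
        linarith [hrad i]
      · exact hxx i j)
  obtain ⟨_, ⟨q, rfl⟩, hq⟩ :=
    Metric.exists_dist_lt_of_hausdorffDist_lt (Set.mem_range_self ⟨p, hp none⟩) hfg hfin
  refine ⟨q, fun i => ?_⟩
  have h1 := dist_triangle4 (g q) (f ⟨p, hp none⟩) (f (x i)) (g ⟨y i, hy i⟩)
  rw [hf.dist_eq, hg.dist_eq, dist_comm (g q), Subtype.dist_eq, Subtype.dist_eq] at h1
  have h2 : dist p (x i) ≤ r i + ε := hp (some i)
  simp only at h1
  linarith [hx i]

/-- "Limit lemma": if the pointed proper metric spaces `(X n, b n)` are injective and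
for every `R > 0` the Gromov–Hausdorff distance between the closed balls
`B(b n, R) ⊆ X n` and `B(c, R) ⊆ Y` tends to `0`, then the proper limit space `Y` is
injective. -/
theorem injective_of_pointed_GH_limit
    (X : ℕ → Type) [∀ n, MetricSpace (X n)] [∀ n, ProperSpace (X n)]
    (b : ∀ n, X n)
    (hinj : ∀ n, IsInjectiveMetricSpace (X n))
    (Y : Type) [MetricSpace Y] [ProperSpace Y] (c : Y)
    (hGH : ∀ R : ℝ, 0 < R → ∀ ε : ℝ, 0 < ε → ∃ N : ℕ, ∀ n ≥ N,
      GHApproxWithin (Metric.closedBall (b n) R) (Metric.closedBall c R) ε) :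
    IsInjectiveMetricSpace Y := by
  have : Nonempty Y := ⟨c⟩
  refine (isHyperconvex_of_finite_approx fun ι _ y r hr ε hε => ?_).isInjectiveMetricSpace
  obtain ⟨R, hR, hyR⟩ := (Set.finite_range y).isBounded.subset_closedBall_lt 0 c
  obtain ⟨N, hN⟩ := hGH R hR (ε / 3) (by positivity)
  have : Nonempty (X N) := ⟨b N⟩
  obtain ⟨q, hq⟩ := (hinj N).isHyperconvex.exists_approx_common_point hR.le (hN N le_rfl) y r
    (fun i => hyR (Set.mem_range_self i)) hr
  exact ⟨q, fun i => (hq i).trans_eq (by ring)⟩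
end

section
/- Let X be a median metric space and let C_1, …, C_n be convex subsets of X such that any two of them have a point in common. Then all of C_1, …, C_n have a common point. -/
/-- A metric space is a *median metric space* if every triple of points has exactly
one median, i.e. `I(x,y) ∩ I(y,z) ∩ I(z,x)` is a singleton. -/
def IsMedianSpace (X : Type) [MetricSpace X] : Prop :=
  ∀ x y z : X, ∃! m : X,
    m ∈ MetricInterval x y ∩ MetricInterval y z ∩ MetricInterval z x

/-- A subset `K` is metrically convex if `I(x,y) ⊆ K` for all `x, y ∈ K`. -/
def MetricallyConvex {X : Type} [PseudoMetricSpace X] (K : Set X) : Prop :=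
  ∀ x ∈ K, ∀ y ∈ K, MetricInterval x y ⊆ K

theorem MetricallyConvex.inter {X : Type} [PseudoMetricSpace X] {K L : Set X}
    (hK : MetricallyConvex K) (hL : MetricallyConvex L) : MetricallyConvex (K ∩ L) :=
  fun x hx y hy _ hz => ⟨hK x hx.1 y hy.1 hz, hL x hx.2 y hy.2 hz⟩

/-- Three pairwise intersecting convex subsets of a median space have a common point. -/
theorem IsMedianSpace.inter_inter_nonempty {X : Type} [MetricSpace X] (hX : IsMedianSpace X)
    {A B C : Set X} (hA : MetricallyConvex A) (hB : MetricallyConvex B)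
    (hC : MetricallyConvex C) (hAB : (A ∩ B).Nonempty) (hBC : (B ∩ C).Nonempty)
    (hAC : (A ∩ C).Nonempty) : (A ∩ B ∩ C).Nonempty := by
  obtain ⟨x, hxA, hxB⟩ := hAB
  obtain ⟨y, hyB, hyC⟩ := hBC
  obtain ⟨z, hzA, hzC⟩ := hAC
  obtain ⟨m, ⟨⟨hxy, hyz⟩, hzx⟩, -⟩ := hX x y z
  exact ⟨m, ⟨hA z hzA x hxA hzx, hB x hxB y hyB hxy⟩, hC y hyC z hzC hyz⟩

/-- In a median space, if a convex set meets every member of a finite pairwise intersecting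
family of convex sets, then it meets their intersection. -/
theorem IsMedianSpace.inter_biInter_nonempty {X ι : Type} [MetricSpace X]
    (hX : IsMedianSpace X) {C : ι → Set X} (hconv : ∀ i, MetricallyConvex (C i))
    (hpair : ∀ i j, (C i ∩ C j).Nonempty) (s : Finset ι) {K : Set X}
    (hK : MetricallyConvex K) (hne : K.Nonempty) (hmeet : ∀ i ∈ s, (K ∩ C i).Nonempty) :
    (K ∩ ⋂ i ∈ s, C i).Nonempty := by
  classical
  induction s using Finset.induction_on generalizing K with
  | empty => simpa using hne
  | insert a s _ ih =>
    have hKa := hmeet a (Finset.mem_insert_self a s)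
    rw [Finset.set_biInter_insert, ← Set.inter_assoc]
    exact ih (hK.inter (hconv a)) hKa fun i hi =>
      hX.inter_inter_nonempty hK (hconv a) (hconv i) hKa (hpair a i)
        (hmeet i (Finset.mem_insert_of_mem hi))

/-- Helly's theorem for median metric spaces: pairwise intersecting convex subsets
`C 1, …, C n` have a common point. -/
theorem helly_median {X : Type} [MetricSpace X] (hX : IsMedianSpace X)
    (n : ℕ) (hn : 0 < n) (C : Fin n → Set X)
    (hconv : ∀ i, MetricallyConvex (C i))
    (hpair : ∀ i j, (C i ∩ C j).Nonempty) :
    (⋂ i, C i).Nonempty := by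
  obtain ⟨x, -, hx⟩ := hX.inter_biInter_nonempty hconv hpair Finset.univ (hconv ⟨0, hn⟩)
    ((hpair ⟨0, hn⟩ ⟨0, hn⟩).mono Set.inter_subset_left) fun i _ => hpair ⟨0, hn⟩ i
  exact ⟨x, by simpa using hx⟩
end

section
/- Let P be a finite poc set and let V be an ultrafilter on P. For a proper element a ∈ V, the set (V ∖ {a}) ∪ {a⋆} is again an ultrafilter on P if and only if a is a minimal element of V. Consequently, the ultrafilters V' with |V ∖ V'| = 1 are exactly the sets (V ∖ {a}) ∪ {a⋆} with a ∈ min(V). -/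
/-- A *poc set*: a poset with least element `⊥` and an order-reversing involution
`pstar` such that `a ≤ pstar a → a = ⊥`. -/
class PocSet (P : Type) extends PartialOrder P, OrderBot P where
  pstar : P → P
  pstar_pstar : ∀ a : P, pstar (pstar a) = a
  pstar_antitone : ∀ {a b : P}, a ≤ b → pstar b ≤ pstar a
  eq_bot_of_le_pstar : ∀ a : P, a ≤ pstar a → a = ⊥

namespace PocSet

variable {P : Type} [PocSet P]

/-- An *ultrafilter* on a poc set: a complete `⋆`-selection (for every `a`, exactly
one of `a`, `a⋆` belongs) which is coherent (no `a, b ∈ U` satisfy `a ≤ b⋆`). -/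
def IsUltra (U : Set P) : Prop :=
  (∀ a : P, a ∈ U ↔ pstar a ∉ U) ∧ ∀ a ∈ U, ∀ b ∈ U, ¬ a ≤ pstar b

/-- Two elements are *nested* if one of the four nesting relations holds. -/
def Nested (a b : P) : Prop :=
  a ≤ b ∨ a ≤ pstar b ∨ pstar a ≤ b ∨ pstar a ≤ pstar b

/-- A set is *nested* if its elements are pairwise nested. -/
def NestedSet (N : Set P) : Prop := ∀ a ∈ N, ∀ b ∈ N, Nested a b

/-- A set is *transverse* if no two distinct elements of it are nested. -/
def Transverse (A : Set P) : Prop := ∀ a ∈ A, ∀ b ∈ A, a ≠ b → ¬ Nested a b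

/-- The set of minimal elements of `V` (w.r.t. the order induced from `P`). -/
def minset (V : Set P) : Set P := {a ∈ V | ∀ b ∈ V, b ≤ a → b = a}

/-- An element is *proper* if it is neither `0` nor `0⋆`. -/
def IsProper (a : P) : Prop := a ≠ ⊥ ∧ a ≠ pstar (⊥ : P)

/-- `d∞(U,W)`: the maximum cardinality of a nested subset of `U \ W`. -/
noncomputable def dinfty (U W : Set P) : ℕ :=
  sSup {n : ℕ | ∃ N : Set P, N ⊆ U \ W ∧ NestedSet N ∧ N.ncard = n}

/-- The `ℓ¹`-distance between ultrafilters on a finite poc set: `|U \ W|`. -/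
noncomputable def ellone (U W : Set P) : ℕ := (U \ W).ncard

end PocSet

open PocSet

namespace PocSet

variable {P : Type} [PocSet P]

theorem IsUltra.pstar_mem_iff {V : Set P} (hV : IsUltra V) {a : P} : pstar a ∈ V ↔ a ∉ V := by
  rw [hV.1 a, not_not]

theorem mem_minset_of_isUltra_flip {V : Set P} {a : P} (ha : a ∈ V)
    (h : IsUltra ((V \ {a}) ∪ {pstar a})) : a ∈ minset V := by
  refine ⟨ha, fun b hb hba => ?_⟩
  by_contra hne
  exact h.2 b (Or.inl ⟨hb, hne⟩) (pstar a) (Or.inr rfl) ((pstar_pstar a).symm ▸ hba)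

theorem isUltra_flip_of_mem_minset {V : Set P} (hV : IsUltra V) {a : P}
    (ha : a ∈ minset V) (ha_top : a ≠ pstar ⊥) : IsUltra ((V \ {a}) ∪ {pstar a}) := by
  obtain ⟨haV, hmin⟩ := ha
  have hstar : pstar a ∉ V := (hV.1 a).1 haV
  refine ⟨fun x => ?_, ?_⟩
  · have hx := hV.1 x
    have hxa : pstar x = a ↔ x = pstar a :=
      ⟨fun h => by rw [← h, pstar_pstar], fun h => by rw [h, pstar_pstar]⟩
    have hxa' : pstar x = pstar a ↔ x = a :=
      ⟨fun h => by rw [← pstar_pstar x, h, pstar_pstar], fun h => by rw [h]⟩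
    simp only [Set.mem_union, Set.mem_sdiff, Set.mem_singleton_iff, hxa, hxa']
    grind
  · rintro b (⟨hb, hba⟩ | rfl) c (⟨hc, hca⟩ | rfl) hbc
    · exact hV.2 b hb c hc hbc
    · rw [pstar_pstar] at hbc
      exact hba (hmin b hb hbc)
    · have := pstar_antitone hbc
      rw [pstar_pstar, pstar_pstar] at this
      exact hca (hmin c hc this)
    · exact ha_top (by rw [← eq_bot_of_le_pstar _ hbc, pstar_pstar])

theorem eq_flip_of_sdiff_eq_singleton {V V' : Set P} (hV : IsUltra V) (hV' : IsUltra V')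
    {a : P} (h : V \ V' = {a}) : V' = (V \ {a}) ∪ {pstar a} := by
  have hmem : ∀ x, x ∈ V ∧ x ∉ V' ↔ x = a := fun x => by
    rw [← Set.mem_sdiff, h, Set.mem_singleton_iff]
  ext x
  simp only [Set.mem_union, Set.mem_sdiff, Set.mem_singleton_iff]
  constructor
  · intro hx
    by_cases hxV : x ∈ V
    · exact Or.inl ⟨hxV, fun hxa => ((hmem x).2 hxa).2 hx⟩
    · right
      rw [← (hmem _).1 ⟨hV.pstar_mem_iff.2 hxV, (hV'.1 x).1 hx⟩, pstar_pstar]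
  · rintro (⟨hxV, hxa⟩ | rfl)
    · by_contra hx
      exact hxa ((hmem x).1 ⟨hxV, hx⟩)
    · exact hV'.pstar_mem_iff.2 ((hmem a).2 rfl).2

theorem sdiff_flip_eq_singleton {V : Set P} (hV : IsUltra V) {a : P} (ha : a ∈ V) :
    V \ ((V \ {a}) ∪ {pstar a}) = {a} := by
  have hne : a ≠ pstar a := fun h => (hV.1 a).1 ha (h ▸ ha)
  ext x
  simp only [Set.mem_union, Set.mem_sdiff, Set.mem_singleton_iff]
  grind

end PocSet

/-- In a finite poc set, flipping an ultrafilter `V` at a proper `a ∈ V` yields an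
ultrafilter iff `a` is minimal in `V`; consequently the ultrafilters `V'` with
`|V \ V'| = 1` are exactly the flips of `V` along minimal elements. -/
theorem flip_ultra_iff_minimal {P : Type} [PocSet P] [Finite P]
    {V : Set P} (hV : IsUltra V) :
    (∀ a ∈ V, IsProper a →
      (IsUltra ((V \ {a}) ∪ {pstar a}) ↔ a ∈ minset V)) ∧
    (∀ V' : Set P, IsUltra V' →
      ((V \ V').ncard = 1 ↔ ∃ a ∈ minset V, V' = (V \ {a}) ∪ {pstar a})) := by
  refine ⟨fun a ha hp => ⟨mem_minset_of_isUltra_flip ha,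
    fun hmin => isUltra_flip_of_mem_minset hV hmin hp.2⟩, fun V' hV' => ?_⟩
  rw [Set.ncard_eq_one]
  constructor
  · rintro ⟨a, ha⟩
    have hflip := eq_flip_of_sdiff_eq_singleton hV hV' ha
    have haV : a ∈ V := (ha.symm ▸ Set.mem_singleton a : a ∈ V \ V').1
    exact ⟨a, mem_minset_of_isUltra_flip haV (hflip ▸ hV'), hflip⟩
  · rintro ⟨a, ha, rfl⟩
    exact ⟨a, sdiff_flip_eq_singleton hV ha.1⟩
end

section
/- Let P be a poc set, V an ultrafilter on P, and A ⊆ min(V) a finite transverse subset. Then for every subset A' ⊆ A, the set (V ∖ A') ∪ {a⋆ : a ∈ A'} is an ultrafilter on P; equivalently, the flips V ↦ (V ∖ {a}) ∪ {a⋆} along the elements of A' can be performed successively in any order, each intermediate set being an ultrafilter, and the outcome is independent of the order. -/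
open PocSet

/-- Flipping an ultrafilter `V` along any subset `A'` of a finite transverse set
`A ⊆ min(V)` of proper elements again yields an ultrafilter; in particular the
flips along the elements of `A'` may be performed successively in any order (each
intermediate set, being of this form, is an ultrafilter) with order-independent
outcome. -/
theorem flips_along_transverse_set {P : Type} [PocSet P]
    {V : Set P} (hV : IsUltra V) {A : Set P}
    (hAmin : A ⊆ minset V) (hAfin : A.Finite) (hAprop : ∀ a ∈ A, IsProper a)
    (hAtrans : Transverse A) :
    ∀ A' ⊆ A, IsUltra ((V \ A') ∪ pstar '' A') := by
  intro A' hA'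
  have hA'V : ∀ a ∈ A', a ∈ V := fun a ha => (hAmin (hA' ha)).1
  have mem_image : ∀ x : P, x ∈ pstar '' A' ↔ pstar x ∈ A' := by
    intro x
    constructor
    · rintro ⟨a, ha, rfl⟩
      rwa [pstar_pstar]
    · intro h
      exact ⟨pstar x, h, pstar_pstar x⟩
  refine ⟨fun x => ?_, ?_⟩
  · have h := hV.1 x
    have hx := hA'V x
    have hsx := hA'V (pstar x)
    simp only [Set.mem_union, Set.mem_sdiff, mem_image, pstar_pstar]
    tauto
  · rintro x (⟨hx, hxA⟩ | ⟨a, ha, rfl⟩) y (⟨hy, hyA⟩ | ⟨b, hb, rfl⟩) hxy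
    · exact hV.2 x hx y hy hxy
    · rw [pstar_pstar] at hxy
      exact hxA ((hAmin (hA' hb)).2 x hx hxy ▸ hb)
    · have hya : y ≤ a := by
        simpa only [pstar_pstar] using pstar_antitone hxy
      exact hyA ((hAmin (hA' ha)).2 y hy hya ▸ ha)
    · by_cases hab : a = b
      · subst hab
        have hbot := eq_bot_of_le_pstar _ hxy
        exact (hAprop a (hA' ha)).2 (by rw [← hbot, pstar_pstar])
      · rw [pstar_pstar] at hxy
        exact hAtrans a (hA' ha) b (hA' hb) hab (Or.inr (Or.inr (Or.inl hxy)))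
end

section
/- Let P be a finite poc set and let U, V, W be ultrafilters on P. Then M = (U ∩ V) ∪ (V ∩ W) ∪ (W ∩ U) is an ultrafilter on P, and with respect to the ℓ¹-distance on ultrafilters, M is the unique element of I(U,V) ∩ I(V,W) ∩ I(W,U); in particular the set of ultrafilters on P with the ℓ¹-distance is a median metric space. -/
namespace PocSet

/-- The majority vote of three ultrafilters is an ultrafilter. -/
theorem IsUltra.median {P : Type} [PocSet P] {U V W : Set P}
    (hU : IsUltra U) (hV : IsUltra V) (hW : IsUltra W) :
    IsUltra ((U ∩ V) ∪ (V ∩ W) ∪ (W ∩ U)) := by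
  refine ⟨fun a => ?_, fun a ha b hb => ?_⟩
  · have := hU.1 a
    have := hV.1 a
    have := hW.1 a
    simp only [Set.mem_union, Set.mem_inter_iff]
    tauto
  · have := hU.2 a
    have := hV.2 a
    have := hW.2 a
    simp only [Set.mem_union, Set.mem_inter_iff] at ha hb
    grind

/-- The excess in the triangle inequality for `ℓ¹` counts the elements on which `Z` differs
from both `U` and `V`. -/
theorem ellone_add_ellone {P : Type} [Finite P] (U V Z : Set P) :
    ellone U Z + ellone Z V =
      ellone U V + (((U ∩ V) \ Z).ncard + (Z \ (U ∪ V)).ncard) := by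
  have h₁ := Set.ncard_inter_add_ncard_sdiff_eq_ncard (U \ Z) V
  have h₂ := Set.ncard_inter_add_ncard_sdiff_eq_ncard (Z \ V) U
  have h₃ := Set.ncard_inter_add_ncard_sdiff_eq_ncard (U \ V) Z
  have e₁ : (U \ Z) ∩ V = (U ∩ V) \ Z := by grind
  have e₂ : (Z \ V) \ U = Z \ (U ∪ V) := by grind
  have e₃ : (U \ V) ∩ Z = (Z \ V) ∩ U := by grind
  have e₄ : (U \ V) \ Z = (U \ Z) \ V := by grind
  rw [e₁] at h₁
  rw [e₂] at h₂
  rw [e₃, e₄] at h₃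
  unfold ellone
  omega

/-- Intervals for the `ℓ¹`-distance: `Z` lies between `U` and `V` iff `U ∩ V ⊆ Z ⊆ U ∪ V`. -/
theorem ellone_add_ellone_eq_iff {P : Type} [Finite P] (U V Z : Set P) :
    ellone U Z + ellone Z V = ellone U V ↔ U ∩ V ⊆ Z ∧ Z ⊆ U ∪ V := by
  rw [ellone_add_ellone, Nat.add_eq_left, Nat.add_eq_zero_iff, Set.ncard_eq_zero,
    Set.ncard_eq_zero, Set.sdiff_eq_empty, Set.sdiff_eq_empty]

end PocSet

open PocSet

/-- For ultrafilters `U, V, W` on a finite poc set, `M = (U∩V) ∪ (V∩W) ∪ (W∩U)` is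
an ultrafilter, and it is the unique common point of the three `ℓ¹`-intervals
`I(U,V)`, `I(V,W)`, `I(W,U)`; in particular the ultrafilters with the
`ℓ¹`-distance form a median metric space. -/
theorem median_of_ultrafilters {P : Type} [PocSet P] [Finite P]
    {U V W : Set P} (hU : IsUltra U) (hV : IsUltra V) (hW : IsUltra W) :
    IsUltra ((U ∩ V) ∪ (V ∩ W) ∪ (W ∩ U)) ∧
    ∀ Z : Set P, IsUltra Z →
      ((ellone U Z + ellone Z V = ellone U V ∧
        ellone V Z + ellone Z W = ellone V W ∧
        ellone W Z + ellone Z U = ellone W U) ↔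
        Z = (U ∩ V) ∪ (V ∩ W) ∪ (W ∩ U)) := by
  refine ⟨hU.median hV hW, fun Z _ => ?_⟩
  simp only [ellone_add_ellone_eq_iff]
  constructor
  · rintro ⟨⟨h₁, h₁'⟩, ⟨h₂, h₂'⟩, ⟨h₃, h₃'⟩⟩
    refine Set.Subset.antisymm (fun a ha => ?_) (Set.union_subset (Set.union_subset h₁ h₂) h₃)
    have := h₁' ha
    have := h₂' ha
    have := h₃' ha
    simp only [Set.mem_union, Set.mem_inter_iff] at *
    tauto
  · rintro rfl
    grind
end

section
/- Let P be a poc set and let U, W be ultrafilters on P. Then every nested subset N of U ∖ W is totally ordered by ≤: for all a, b ∈ N, either a ≤ b or b ≤ a. -/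
open PocSet

/-- Every nested subset of `U \ W` (for ultrafilters `U`, `W`) is totally ordered
by `≤`. -/
theorem nested_subset_is_chain {P : Type} [PocSet P]
    {U W : Set P} (hU : IsUltra U) (hW : IsUltra W)
    {N : Set P} (hNsub : N ⊆ U \ W) (hN : NestedSet N) :
    ∀ a ∈ N, ∀ b ∈ N, a ≤ b ∨ b ≤ a := by
  intro a ha b hb
  obtain ⟨haU, haW⟩ := hNsub ha
  obtain ⟨hbU, hbW⟩ := hNsub hb
  have haW' : pstar a ∈ W := not_not.mp fun h => haW ((hW.1 a).mpr h)
  have hbW' : pstar b ∈ W := not_not.mp fun h => hbW ((hW.1 b).mpr h)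
  rcases hN a ha b hb with h | h | h | h
  · exact Or.inl h
  · exact absurd h (hU.2 a haU b hbU)
  · exact absurd (by rwa [pstar_pstar]) (hW.2 _ haW' _ hbW')
  · right
    simpa only [pstar_pstar] using pstar_antitone h
end

section
/- Let P be a poc set and let U, W be ultrafilters on P. Then the set min(U ∖ W) of minimal elements of U ∖ W is transverse: no two distinct minimal elements of U ∖ W are nested. -/
open PocSet

/-- For ultrafilters `U`, `W`, the set of minimal elements of `U \ W` is
transverse: no two distinct minimal elements are nested. -/
theorem minset_diff_transverse {P : Type} [PocSet P]
    {U W : Set P} (hU : IsUltra U) (hW : IsUltra W) :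
    Transverse (minset (U \ W)) := by
  have mem_pstar : ∀ {a : P}, a ∉ W → pstar a ∈ W := fun {a} ha =>
    (hW.1 (pstar a)).2 (by rwa [pstar_pstar])
  rintro a ⟨ha, ha_min⟩ b ⟨hb, hb_min⟩ hne (h | h | h | h)
  · exact hne (hb_min a ha h)
  · exact hU.2 a ha.1 b hb.1 h
  · refine hW.2 _ (mem_pstar ha.2) _ (mem_pstar hb.2) ?_
    rwa [pstar_pstar]
  · have hba := pstar_antitone h
    rw [pstar_pstar, pstar_pstar] at hba
    exact hne (ha_min b hb hba).symm
end

section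
/- Let P be a finite poc set and let U, W be ultrafilters on P. The normal cube path from U to W terminates: there is m ∈ ℕ with U_m = W, and this m equals the maximum cardinality of a nested subset of U ∖ W (equivalently, by the previous, of a chain in U ∖ W). -/
open PocSet

/-- One step of the normal cube path towards `W`: flip all minimal elements of
`V \ W` simultaneously. -/
def normalStep {P : Type} [PocSet P] (W V : Set P) : Set P :=
  (V \ minset (V \ W)) ∪ pstar '' minset (V \ W)

/-- The normal cube path from `U` to `W`: `U_0 = U`,
`U_{k+1} = (U_k \ min(U_k \ W)) ∪ {a⋆ : a ∈ min(U_k \ W)}`. -/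
def ncp {P : Type} [PocSet P] (U W : Set P) : ℕ → Set P
  | 0 => U
  | k + 1 => normalStep W (ncp U W k)

namespace PocSet

variable {P : Type} [PocSet P]

theorem Nested.le_or_le {U W : Set P} (hU : IsUltra U) (hW : IsUltra W) {a b : P}
    (ha : a ∈ U \ W) (hb : b ∈ U \ W) (h : Nested a b) : a ≤ b ∨ b ≤ a := by
  have mem_star : ∀ {c : P}, c ∈ U \ W → pstar c ∈ W := fun hc ↦
    not_not.1 fun hn ↦ hc.2 ((hW.1 _).2 hn)
  rcases h with h | h | h | h
  · exact .inl h
  · exact absurd h (hU.2 a ha.1 b hb.1)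
  · exact absurd ((pstar_pstar b).symm ▸ h) (hW.2 _ (mem_star ha) _ (mem_star hb))
  · have := pstar_antitone h
    rw [pstar_pstar, pstar_pstar] at this
    exact .inr this

theorem normalStep_sdiff {W : Set P} (hW : IsUltra W) (V : Set P) :
    normalStep W V \ W = (V \ W) \ minset (V \ W) := by
  ext x
  constructor
  · rintro ⟨⟨hV, hm⟩ | ⟨a, ha, rfl⟩, hx⟩
    · exact ⟨⟨hV, hx⟩, hm⟩
    · exact absurd ((hW.1 a).2 hx) ha.1.2
  · rintro ⟨⟨hV, hx⟩, hm⟩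
    exact ⟨.inl ⟨hV, hm⟩, hx⟩

theorem mem_normalStep_iff_pstar_notMem {V : Set P} (W : Set P)
    (hV : ∀ a : P, a ∈ V ↔ pstar a ∉ V) (a : P) :
    a ∈ normalStep W V ↔ pstar a ∉ normalStep W V := by
  have hsub : ∀ b ∈ minset (V \ W), b ∈ V := fun b hb ↦ hb.1.1
  have mem_image : ∀ b : P, b ∈ pstar '' minset (V \ W) ↔ pstar b ∈ minset (V \ W) := by
    intro b
    constructor
    · rintro ⟨c, hc, rfl⟩
      rwa [pstar_pstar]
    · exact fun hb ↦ ⟨_, hb, pstar_pstar b⟩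
  simp only [normalStep, Set.mem_union, Set.mem_sdiff, mem_image, pstar_pstar]
  have h₁ := hV a
  have h₂ := hsub a
  have h₃ := hsub (pstar a)
  tauto

theorem mem_ncp_iff_pstar_notMem {U : Set P} (W : Set P) (hU : IsUltra U) (k : ℕ) :
    ∀ a : P, a ∈ ncp U W k ↔ pstar a ∉ ncp U W k := by
  induction k with
  | zero => exact hU.1
  | succ k ih => exact mem_normalStep_iff_pstar_notMem W ih

theorem ncp_eq_iff {U W : Set P} (hU : IsUltra U) (hW : IsUltra W) (k : ℕ) :
    ncp U W k = W ↔ ncp U W k \ W = ∅ := by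
  refine ⟨fun h ↦ by rw [h, Set.sdiff_self], fun h ↦ ?_⟩
  have hsub := Set.sdiff_eq_empty.1 h
  refine hsub.antisymm fun a ha ↦ ?_
  exact (mem_ncp_iff_pstar_notMem W hU k a).2 fun hs ↦ (hW.1 a).1 ha (hsub hs)

theorem ncp_sdiff_succ {U W : Set P} (hW : IsUltra W) (k : ℕ) :
    ncp U W (k + 1) \ W = (ncp U W k \ W) \ minset (ncp U W k \ W) :=
  normalStep_sdiff hW _

/-- An element still to be flipped after `k` steps tops a nested set of size `k + 1`. -/
theorem exists_nestedSet_of_mem_ncp_sdiff [Finite P] {U W : Set P} (hW : IsUltra W) (k : ℕ) :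
    ∀ x ∈ ncp U W k \ W, x ∈ U \ W ∧ ∃ N : Set P, N ⊆ U \ W ∧ NestedSet N ∧
      N.ncard = k + 1 ∧ ∀ y ∈ N, y ≤ x := by
  induction k with
  | zero =>
    intro x hx
    refine ⟨hx, {x}, Set.singleton_subset_iff.2 hx, ?_, Set.ncard_singleton x, ?_⟩
    · rintro a rfl b rfl
      exact .inl le_rfl
    · rintro y rfl
      exact le_rfl
  | succ k ih =>
    intro x hx
    rw [ncp_sdiff_succ hW] at hx
    obtain ⟨hx, hmin⟩ := hx
    have hxU := (ih x hx).1
    obtain ⟨y, hy, hyx, hne⟩ : ∃ y ∈ ncp U W k \ W, y ≤ x ∧ y ≠ x := by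
      by_contra! h
      exact hmin ⟨hx, h⟩
    obtain ⟨-, N, hN, hnest, hcard, hle⟩ := ih y hy
    have hxN : x ∉ N := fun h ↦ hne (hyx.antisymm (hle x h))
    have hle' : ∀ z ∈ N, z ≤ x := fun z hz ↦ (hle z hz).trans hyx
    refine ⟨hxU, insert x N, Set.insert_subset hxU hN, ?_, ?_, ?_⟩
    · rintro a (rfl | ha) b (rfl | hb)
      · exact .inl le_rfl
      · exact .inr (.inr (.inr (pstar_antitone (hle' b hb))))
      · exact .inl (hle' a ha)
      · exact hnest a ha b hb
    · rw [Set.ncard_insert_of_notMem hxN, hcard]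
    · rintro z (rfl | hz)
      · exact le_rfl
      · exact hle' z hz

/-- Each step flips at most one element of a nested set. -/
theorem NestedSet.ncard_le [Finite P] {U W : Set P} (hU : IsUltra U) (hW : IsUltra W)
    {N : Set P} (hN : N ⊆ U \ W) (hnest : NestedSet N) (k : ℕ) :
    N.ncard ≤ (N ∩ (ncp U W k \ W)).ncard + k := by
  induction k with
  | zero =>
    change N.ncard ≤ (N ∩ (U \ W)).ncard + 0
    rw [Set.inter_eq_left.2 hN, add_zero]
  | succ k ih =>
    rw [ncp_sdiff_succ hW]
    set D := ncp U W k \ W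
    have hone : (N ∩ minset D).ncard ≤ 1 := by
      refine (Set.ncard_le_one (Set.toFinite _)).2 ?_
      rintro a ⟨ha, ham⟩ b ⟨hb, hbm⟩
      rcases (hnest a ha b hb).le_or_le hU hW (hN ha) (hN hb) with h | h
      · exact hbm.2 a ham.1 h
      · exact (ham.2 b hbm.1 h).symm
    have hcover : N ∩ D ⊆ (N ∩ (D \ minset D)) ∪ (N ∩ minset D) := by
      rintro a ⟨ha, hD⟩
      by_cases hm : a ∈ minset D
      · exact .inr ⟨ha, hm⟩
      · exact .inl ⟨ha, hD, hm⟩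
    have := (Set.ncard_le_ncard hcover (Set.toFinite _)).trans (Set.ncard_union_le _ _)
    omega

theorem NestedSet.ncard_le_dinfty [Finite P] {U W N : Set P} (hN : N ⊆ U \ W)
    (hnest : NestedSet N) : N.ncard ≤ dinfty U W := by
  refine le_csSup ⟨Nat.card P, ?_⟩ ⟨N, hN, hnest, rfl⟩
  rintro n ⟨M, -, -, rfl⟩
  exact Set.ncard_le_card M

end PocSet

/-- The normal cube path from `U` to `W` terminates, reaching `W` for the first
time exactly at step `m = d∞(U,W)`, the maximum cardinality of a nested subset
(equivalently, a chain) of `U \ W`. -/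
theorem normal_cube_path_terminates {P : Type} [PocSet P] [Finite P]
    {U W : Set P} (hU : IsUltra U) (hW : IsUltra W) :
    ncp U W (dinfty U W) = W ∧ ∀ k < dinfty U W, ncp U W k ≠ W := by
  constructor
  · rw [ncp_eq_iff hU hW, Set.eq_empty_iff_forall_notMem]
    intro x hx
    obtain ⟨-, N, hN, hnest, hcard, -⟩ := exists_nestedSet_of_mem_ncp_sdiff hW _ x hx
    have := hnest.ncard_le_dinfty hN
    omega
  · intro k hk h
    refine hk.not_ge (csSup_le ⟨0, ∅, Set.empty_subset _, ?_, Set.ncard_empty P⟩ ?_)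
    · exact fun a ha ↦ ha.elim
    · rintro n ⟨N, hN, hnest, rfl⟩
      have := hnest.ncard_le hU hW hN k
      rwa [(ncp_eq_iff hU hW k).1 h, Set.inter_empty, Set.ncard_empty, zero_add] at this
end

section
/- Let P be a finite poc set, U, W ultrafilters on P, and let U_0 = U, U_1, …, U_m = W be the normal cube path from U to W. Then d∞(U_i, U_j) = j − i for all 0 ≤ i ≤ j ≤ m; in particular normal cube paths are geodesic for the distance d∞. -/
open PocSet

namespace PocSet

variable {P : Type} [PocSet P]

theorem IsUltra.pstar_mem {U : Set P} (hU : IsUltra U) {a : P} (ha : a ∉ U) : pstar a ∈ U := by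
  by_contra h
  exact ha ((hU.1 a).2 h)

theorem exists_mem_minset_le [Finite P] {V : Set P} {x : P} (hx : x ∈ V) :
    ∃ y ∈ minset V, y ≤ x := by
  obtain ⟨y, hyx, hy⟩ := V.toFinite.exists_le_minimal hx
  exact ⟨y, ⟨hy.prop, fun b hb hle => le_antisymm hle (hy.le_of_le hb hle)⟩, hyx⟩

theorem NestedSet.insert {N : Set P} (hN : NestedSet N) {y : P} (hy : ∀ a ∈ N, a < y) :
    NestedSet (insert y N) := by
  rintro a (rfl | ha) b (rfl | hb)
  · exact Or.inl le_rfl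
  · exact Or.inr (Or.inr (Or.inr (pstar_antitone (hy b hb).le)))
  · exact Or.inl (hy a ha).le
  · exact hN a ha b hb

theorem dinfty_eq_of_le_of_exists {U W : Set P} {n : ℕ}
    (hle : ∀ N ⊆ U \ W, NestedSet N → N.ncard ≤ n)
    (hex : ∃ N ⊆ U \ W, NestedSet N ∧ N.ncard = n) : dinfty U W = n := by
  refine IsGreatest.csSup_eq ⟨hex, ?_⟩
  rintro _ ⟨N, hN, hnest, rfl⟩
  exact hle N hN hnest

end PocSet

section NormalCubePath

variable {P : Type} [PocSet P] {U W : Set P}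

theorem normalStep_diff (hW : IsUltra W) (V : Set P) :
    normalStep W V \ W = (V \ W) \ minset (V \ W) := by
  ext x
  constructor
  · rintro ⟨⟨hx, hmin⟩ | ⟨a, ha, rfl⟩, hxW⟩
    · exact ⟨⟨hx, hxW⟩, hmin⟩
    · exact absurd (hW.pstar_mem ha.1.2) hxW
  · rintro ⟨⟨hx, hxW⟩, hmin⟩
    exact ⟨Or.inl ⟨hx, hmin⟩, hxW⟩

theorem ncp_succ_diff (hW : IsUltra W) (k : ℕ) :
    ncp U W (k + 1) \ W = (ncp U W k \ W) \ minset (ncp U W k \ W) :=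
  normalStep_diff hW _

theorem antitone_ncp_diff (hW : IsUltra W) : Antitone fun k => ncp U W k \ W :=
  antitone_nat_of_succ_le fun k => (ncp_succ_diff hW k).trans_subset Set.sdiff_subset

theorem monotone_ncp_inter : Monotone fun k => ncp U W k ∩ W :=
  monotone_nat_of_le_succ fun _ _ hx => ⟨Or.inl ⟨hx.1, fun h => h.1.2 hx.2⟩, hx.2⟩

theorem ncp_diff_ncp {i j : ℕ} (hij : i ≤ j) :
    ncp U W i \ ncp U W j = (ncp U W i \ W) \ (ncp U W j \ W) := by
  ext x
  constructor
  · rintro ⟨hi, hj⟩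
    exact ⟨⟨hi, fun hxW => hj (monotone_ncp_inter hij ⟨hi, hxW⟩).1⟩, fun h => hj h.1⟩
  · rintro ⟨⟨hi, hxW⟩, hj⟩
    exact ⟨hi, fun h => hj ⟨h, hxW⟩⟩

theorem mem_ncp_or_pstar_mem_ncp (hU : IsUltra U) (k : ℕ) (a : P) :
    a ∈ ncp U W k ∨ pstar a ∈ ncp U W k := by
  have step : ∀ {V : Set P} {b : P}, b ∈ V →
      b ∈ normalStep W V ∨ pstar b ∈ normalStep W V := fun {V b} hb => by
    by_cases hmin : b ∈ minset (V \ W)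
    · exact Or.inr (Or.inr ⟨b, hmin, rfl⟩)
    · exact Or.inl (Or.inl ⟨hb, hmin⟩)
  induction k with
  | zero => exact or_iff_not_imp_left.2 hU.pstar_mem
  | succ k ih =>
    rcases ih with h | h
    · exact step h
    · have := step h
      rw [pstar_pstar] at this
      exact this.symm

theorem ncp_eq_of_diff_eq_empty (hU : IsUltra U) (hW : IsUltra W) {k : ℕ}
    (h : ncp U W k \ W = ∅) : ncp U W k = W := by
  have hsub := Set.sdiff_eq_empty.1 h
  refine hsub.antisymm fun a ha => ?_
  exact (mem_ncp_or_pstar_mem_ncp hU k a).resolve_right fun h' => (hW.1 a).1 ha (hsub h')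

theorem ncard_le_of_nestedSet_ncp_diff [Finite P] (hU : IsUltra U) (hW : IsUltra W) (i n : ℕ)
    {N : Set P} (hN : N ⊆ (ncp U W i \ W) \ (ncp U W (i + n) \ W)) (hnest : NestedSet N) :
    N.ncard ≤ n := by
  induction n generalizing N with
  | zero => simp_all
  | succ n ih =>
    set D := ncp U W (i + n) \ W
    have hbefore : (N \ D).ncard ≤ n :=
      ih (fun x hx => ⟨(hN hx.1).1, hx.2⟩) fun a ha b hb => hnest a ha.1 b hb.1
    have hmin : ∀ a ∈ N ∩ D, a ∈ minset D := fun a ha => by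
      by_contra h
      refine (hN ha.1).2 ?_
      rw [← add_assoc, ncp_succ_diff hW]
      exact ⟨ha.2, h⟩
    have hlayer : (N ∩ D).ncard ≤ 1 := by
      refine (Set.ncard_le_one_iff (Set.toFinite _)).2 fun {a b} ha hb => ?_
      have hanti := antitone_ncp_diff (U := U) hW (Nat.zero_le (i + n))
      rcases (hnest a ha.1 b hb.1).le_or_le hU hW (hanti ha.2) (hanti hb.2) with h | h
      · exact (hmin b hb).2 a ha.2 h
      · exact ((hmin a ha).2 b hb.2 h).symm
    have := Set.ncard_inter_add_ncard_sdiff_eq_ncard N D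
    omega

theorem mem_ncp_diff_of_mem_minset (hW : IsUltra W) {i k : ℕ} (hik : i ≤ k) {y : P}
    (hy : y ∈ minset (ncp U W k \ W)) : y ∈ (ncp U W i \ W) \ (ncp U W (k + 1) \ W) := by
  rw [ncp_succ_diff hW k]
  exact ⟨antitone_ncp_diff hW hik hy.1, fun h => h.2 hy⟩

/-- A minimal element of the `(i + n)`-th difference tops a nested set with one element from
each of the layers `i, …, i + n`. -/
theorem exists_nestedSet_le_of_mem_minset [Finite P] (hW : IsUltra W) (i n : ℕ) {y : P}
    (hy : y ∈ minset (ncp U W (i + n) \ W)) :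
    ∃ N ⊆ (ncp U W i \ W) \ (ncp U W (i + n + 1) \ W),
      NestedSet N ∧ N.ncard = n + 1 ∧ ∀ a ∈ N, a ≤ y := by
  induction n generalizing y with
  | zero =>
    exact ⟨{y}, by simpa using mem_ncp_diff_of_mem_minset hW (Nat.le_add_right i 0) hy,
      by simp [NestedSet, Nested], by simp, by simp⟩
  | succ n ih =>
    have hy' := hy.1
    rw [← add_assoc, ncp_succ_diff hW] at hy'
    obtain ⟨z, hz, hzy⟩ := exists_mem_minset_le hy'.1
    have hlt : z < y := lt_of_le_of_ne hzy fun h => hy'.2 (h ▸ hz)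
    obtain ⟨N, hN, hnest, hcard, hNz⟩ := ih hz
    have hNy : ∀ a ∈ N, a < y := fun a ha => (hNz a ha).trans_lt hlt
    refine ⟨insert y N, Set.insert_subset ?_ fun a ha => ?_, hnest.insert hNy, ?_, ?_⟩
    · exact mem_ncp_diff_of_mem_minset hW (Nat.le_add_right i (n + 1)) hy
    · exact ⟨(hN ha).1, fun h => (hN ha).2 (antitone_ncp_diff hW (Nat.le_succ _) h)⟩
    · rw [Set.ncard_insert_of_notMem fun h => (hNy y h).false, hcard]
    · exact Set.forall_mem_insert.2 ⟨le_rfl, fun a ha => (hNy a ha).le⟩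

theorem exists_nestedSet_ncp_diff [Finite P] (hW : IsUltra W) (i n : ℕ)
    (hne : ∀ k < i + n, (ncp U W k \ W).Nonempty) :
    ∃ N ⊆ (ncp U W i \ W) \ (ncp U W (i + n) \ W), NestedSet N ∧ N.ncard = n := by
  cases n with
  | zero => exact ⟨∅, Set.empty_subset _, by simp [NestedSet], by simp⟩
  | succ n =>
    obtain ⟨x, hx⟩ := hne (i + n) (by omega)
    obtain ⟨y, hy, -⟩ := exists_mem_minset_le hx
    obtain ⟨N, hN, hnest, hcard, -⟩ := exists_nestedSet_le_of_mem_minset hW i n hy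
    exact ⟨N, hN, hnest, hcard⟩

end NormalCubePath

/-- Along the normal cube path `U_0 = U, …, U_m = W` (with `m` the first index at
which the path reaches `W`), one has `d∞(U_i, U_j) = j - i` for all
`0 ≤ i ≤ j ≤ m`; in particular normal cube paths are geodesic for `d∞`. -/
theorem normal_cube_path_geodesic {P : Type} [PocSet P] [Finite P]
    {U W : Set P} (hU : IsUltra U) (hW : IsUltra W)
    {m : ℕ} (hm : ncp U W m = W) (hfirst : ∀ k < m, ncp U W k ≠ W) :
    ∀ i j : ℕ, i ≤ j → j ≤ m → dinfty (ncp U W i) (ncp U W j) = j - i := by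
  intro i j hij hjm
  obtain ⟨n, rfl⟩ := Nat.exists_eq_add_of_le hij
  rw [Nat.add_sub_cancel_left]
  apply dinfty_eq_of_le_of_exists
  · rw [ncp_diff_ncp hij]
    exact fun _ => ncard_le_of_nestedSet_ncp_diff hU hW i n
  · rw [ncp_diff_ncp hij]
    refine exists_nestedSet_ncp_diff hW i n fun k hk => Set.nonempty_iff_ne_empty.2 fun h => ?_
    exact hfirst k (hk.trans_le hjm) (ncp_eq_of_diff_eq_empty hU hW h)
end
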